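/- arXiv:math/0203177 — 2 statements merged into one kernel-verified Lean document; each statement's English description precedes it below -/
import Mathlib

section
/- Let p be any probability vector on {1,…,k}. For every n≥1, every path g:{0,…,n}→ℤ_+^k with g(0)=0, unit increments g(m)−g(m−1)∈{e_1,…,e_k}, and g(m)∈W for all m≤n, and every y∈ℤ_+^k with |y|=n, the joint law of the transformed walk and the position of the original walk is: P((G^{(k)}(X))(m)=g(m) for all m≤n, and X(n)=y) = p^y·κ_{g(n)^*, y}, where κ is the Kostka number. -/
open MeasureTheory ProbabilityTheory

noncomputable def minOp (x y : ℕ → ℤ) : ℕ → ℤ := fun n =>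
  Finset.inf' (Finset.range (n+1)) (by simp) (fun m => x m + y n - y m)

noncomputable def maxOp (x y : ℕ → ℤ) : ℕ → ℤ := fun n =>
  Finset.sup' (Finset.range (n+1)) (by simp) (fun m => x m + y n - y m)

/-- `Dseq x i = x 0 ⊓ x 1 ⊓ ⋯ ⊓ x i` (left to right). -/
noncomputable def Dseq (x : ℕ → ℕ → ℤ) : ℕ → (ℕ → ℤ)
  | 0 => x 0
  | i+1 => minOp (Dseq x i) (x (i+1))

/-- `Tseq x i = x (i+1) ⊔ (x 0 ⊓ ⋯ ⊓ x i)`. -/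
noncomputable def Tseq (x : ℕ → ℕ → ℤ) : ℕ → (ℕ → ℤ) :=
  fun i => maxOp (x (i+1)) (Dseq x i)

/-- The path transformation `G^{(k)}` (coordinates `0,…,k-1`). -/
noncomputable def G : ℕ → (ℕ → ℕ → ℤ) → (ℕ → ℕ → ℤ)
  | 0, x => x
  | 1, x => x
  | (k+2), x => fun i => match i with
      | 0 => Dseq x (k+1)
      | (j+1) => G (k+1) (Tseq x) j

/-- The cells of the Young diagram of shape `lam` (row lengths), within the
first `k` rows. -/
def cells (k : ℕ) (lam : ℕ → ℕ) : Finset (ℕ × ℕ) :=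
  (Finset.range k ×ˢ Finset.range ((Finset.range k).sup lam)).filter
    (fun rc => rc.2 < lam rc.1)

/-- `T` is a semistandard Young tableau of shape `lam` with entries in
`{0,…,k-1}` (0-based version of entries `{1,…,k}`): rows weakly increase,
columns strictly increase, and `T` vanishes outside the diagram. -/
def IsSSYT (k : ℕ) (lam : ℕ → ℕ) (T : ℕ → ℕ → ℕ) : Prop :=
  (∀ r c, c < lam r → T r c < k) ∧
  (∀ r c, ¬ c < lam r → T r c = 0) ∧
  (∀ r c c', c ≤ c' → c' < lam r → T r c ≤ T r c') ∧
  (∀ r r' c, r < r' → c < lam r' → T r c < T r' c)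

/-- Number of entries of `T` (of shape `lam`, within `k` rows) equal to `i`. -/
def entryCount (k : ℕ) (lam : ℕ → ℕ) (T : ℕ → ℕ → ℕ) (i : ℕ) : ℕ :=
  ((cells k lam).filter (fun rc => T rc.1 rc.2 = i)).card

/-- The Schur polynomial `s_lam(p) = ∑_T p^{weight(T)}`, summing over all
semistandard tableaux of shape `lam` with entries in `{0,…,k-1}`. -/
noncomputable def schur (k : ℕ) (lam : ℕ → ℕ) (p : ℕ → ℝ) : ℝ :=
  ∑' T : {T : ℕ → ℕ → ℕ // IsSSYT k lam T},
    ∏ i ∈ Finset.range k, p i ^ entryCount k lam T.1 i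

/-- The Kostka number `κ_{lam,w}`: the number of semistandard tableaux of shape
`lam` with entries in `{0,…,k-1}` and weight `w`. -/
noncomputable def kostka (k : ℕ) (lam : ℕ → ℕ) (w : ℕ → ℕ) : ℕ :=
  Set.ncard {T : ℕ → ℕ → ℕ | IsSSYT k lam T ∧ ∀ i, i < k → entryCount k lam T i = w i}

/-- The reversed vector `x^*` of a nonnegative integer vector, as a shape. -/
def revPartZ (k : ℕ) (x : ℕ → ℤ) : ℕ → ℕ :=
  fun j => if j < k then (x (k-1-j)).toNat else 0

/-- The counting walk of the i.i.d. letters `ξ`: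
`Xcnt ξ i n ω = #{m < n : ξ m ω = i}` (as an integer). -/
def Xcnt {Ω : Type*} (ξ : ℕ → Ω → ℕ) (i : ℕ) (n : ℕ) (ω : Ω) : ℤ :=
  ((((Finset.range n).filter (fun m => ξ m ω = i))).card : ℤ)

theorem minOp_zero (x y : ℕ → ℤ) : minOp x y 0 = x 0 := by
  simp [minOp]

theorem minOp_succ (x y : ℕ → ℤ) (n : ℕ) :
    minOp x y (n+1) = min (minOp x y n + y (n+1) - y n) (x (n+1)) := by
  apply le_antisymm
  · apply le_min
    · obtain ⟨m, hm, h⟩ := Finset.exists_mem_eq_inf' (s := Finset.range (n+1)) (by simp)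
        (fun m => x m + y n - y m)
      have h1 : minOp x y n = x m + y n - y m := h
      have h2 : minOp x y (n+1) ≤ x m + y (n+1) - y m :=
        Finset.inf'_le (fun m => x m + y (n+1) - y m) (by simp at hm ⊢; omega)
      omega
    · have h2 : minOp x y (n+1) ≤ x (n+1) + y (n+1) - y (n+1) :=
        Finset.inf'_le (fun m => x m + y (n+1) - y m) (by simp)
      omega
  · obtain ⟨m, hm, h⟩ := Finset.exists_mem_eq_inf' (s := Finset.range (n+1+1)) (by simp)
        (fun m => x m + y (n+1) - y m)
    have h1 : minOp x y (n+1) = x m + y (n+1) - y m := h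
    rw [h1]
    by_cases hmn : m = n+1
    · subst hmn
      exact (min_le_right _ _).trans (by omega)
    · have h2 : minOp x y n ≤ x m + y n - y m :=
        Finset.inf'_le (fun m => x m + y n - y m) (by simp at hm ⊢; omega)
      exact (min_le_left _ _).trans (by omega)

theorem maxOp_eq (x y : ℕ → ℤ) (n : ℕ) : maxOp x y n = x n + y n - minOp y x n := by
  apply le_antisymm
  · obtain ⟨m, hm, h⟩ := Finset.exists_mem_eq_sup' (s := Finset.range (n+1)) (by simp)
        (fun m => x m + y n - y m)
    have h1 : maxOp x y n = x m + y n - y m := h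
    have h2 : minOp y x n ≤ y m + x n - x m :=
      Finset.inf'_le (fun m => y m + x n - x m) hm
    omega
  · obtain ⟨m, hm, h⟩ := Finset.exists_mem_eq_inf' (s := Finset.range (n+1)) (by simp)
        (fun m => y m + x n - x m)
    have h1 : minOp y x n = y m + x n - x m := h
    have h2 : x m + y n - y m ≤ maxOp x y n :=
      Finset.le_sup' (fun m => x m + y n - y m) hm
    omega

/-- The successive overflow paths when a new coordinate `x` is fed through the paths `a`. -/
noncomputable def Sov (a : ℕ → ℕ → ℤ) (x : ℕ → ℤ) : ℕ → (ℕ → ℤ)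
  | 0 => x
  | i+1 => maxOp (Sov a x i) (a i)

theorem Sov_shift (a : ℕ → ℕ → ℤ) (x : ℕ → ℤ) (i : ℕ) :
    Sov a x (i+1) = Sov (fun j => a (j+1)) (maxOp x (a 0)) i := by
  induction i with
  | zero => rfl
  | succ i ih => rw [Sov, ih]; rfl

theorem G_zero_coord (r : ℕ) (x : ℕ → ℕ → ℤ) : G (r+1) x 0 = Dseq x r := by
  cases r <;> rfl

theorem G_struct (r : ℕ) : ∀ (x : ℕ → ℕ → ℤ),
    (∀ i < r, G (r+1) x i = minOp (G r x i) (Sov (G r x) (x r) i)) ∧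
    G (r+1) x r = Sov (G r x) (x r) r := by
  induction r with
  | zero => intro x; exact ⟨by simp, rfl⟩
  | succ r ih =>
    intro x
    cases r with
    | zero =>
      refine ⟨?_, rfl⟩
      intro i hi
      obtain rfl : i = 0 := by omega
      rfl
    | succ r =>
      obtain ⟨h1, h2⟩ := ih (Tseq x)
      have hs : ∀ j, Sov (G (r+2) x) (x (r+2)) (j+1)
          = Sov (G (r+1) (Tseq x)) (Tseq x (r+1)) j := by
        intro j
        rw [Sov_shift]; rfl
      constructor
      · intro i hi
        cases i with
        | zero => rfl
        | succ j =>
          rw [hs]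
          exact h1 j (by omega)
      · rw [hs]
        exact h2

/-- Position of the `i`-th overflow path. -/
def XX (a : ℕ → ℕ → ℤ) (x : ℕ → ℤ) (b : ℕ → ℕ → ℤ) (i m : ℕ) : ℤ :=
  x m + ∑ j ∈ Finset.range i, (a j m - b j m)

structure QRel (r n : ℕ) (a : ℕ → ℕ → ℤ) (x : ℕ → ℤ) (b : ℕ → ℕ → ℤ) : Prop where
  zero : ∀ i < r, b i 0 = a i 0
  step : ∀ i < r, ∀ m < n,
    b i (m+1) = min (b i m + XX a x b i (m+1) - XX a x b i m) (a i (m+1))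
  last : ∀ m ≤ n, b r m = XX a x b r m

theorem G_rel (r n : ℕ) (x : ℕ → ℕ → ℤ) : QRel r n (G r x) (x r) (G (r+1) x) := by
  obtain ⟨h1, h2⟩ := G_struct r x
  have hS : ∀ i ≤ r, ∀ m, Sov (G r x) (x r) i m = XX (G r x) (x r) (G (r+1) x) i m := by
    intro i
    induction i with
    | zero => intro _ m; simp [XX, Sov]
    | succ i ih =>
      intro hi m
      rw [Sov, maxOp_eq, ← h1 i (by omega), ih (by omega)]
      simp only [XX, Finset.sum_range_succ]
      ring
  refine ⟨?_, ?_, ?_⟩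
  · intro i hi
    rw [h1 i hi, minOp_zero]
  · intro i hi m hm
    rw [h1 i hi, minOp_succ, hS i hi.le, hS i hi.le]
  · intro m _
    rw [h2, hS r le_rfl]

structure PathOn (r n : ℕ) (x : ℕ → ℕ → ℤ) : Prop where
  zero : ∀ i < r, x i 0 = 0
  mono : ∀ i < r, ∀ m < n, x i m ≤ x i (m+1)
  step : ∀ m < n, ∑ i ∈ Finset.range r, x i (m+1) ≤ ∑ i ∈ Finset.range r, x i m + 1

def Wc (r n : ℕ) (x : ℕ → ℕ → ℤ) : Prop := ∀ m ≤ n, ∀ i, i + 1 < r → x i m ≤ x (i+1) m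

def Ilace (r : ℕ) (a b : ℕ → ℤ) : Prop := ∀ i < r, b i ≤ a i ∧ a i ≤ b (i+1)

/-- joint path condition for the pair `(a, x)` -/
structure Joint (r n : ℕ) (a : ℕ → ℕ → ℤ) (x : ℕ → ℤ) : Prop where
  zero : ∀ i < r, a i 0 = 0
  mono : ∀ i < r, ∀ m < n, a i m ≤ a i (m+1)
  xzero : x 0 = 0
  xmono : ∀ m < n, x m ≤ x (m+1)
  step : ∀ m < n, ∑ i ∈ Finset.range r, a i (m+1) + x (m+1)
    ≤ ∑ i ∈ Finset.range r, a i m + x m + 1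

theorem QRel.sum {r n : ℕ} {a b : ℕ → ℕ → ℤ} {x : ℕ → ℤ} (h : QRel r n a x b) {m : ℕ}
    (hm : m ≤ n) :
    ∑ i ∈ Finset.range (r+1), b i m = ∑ i ∈ Finset.range r, a i m + x m := by
  rw [Finset.sum_range_succ, h.last m hm, XX, Finset.sum_sub_distrib]
  ring

theorem XX_succ (a b : ℕ → ℕ → ℤ) (x : ℕ → ℤ) (i m : ℕ) :
    XX a x b (i+1) m = XX a x b i m + a i m - b i m := by
  simp only [XX, Finset.sum_range_succ]; ring

theorem fwd_s {r n : ℕ} {a b : ℕ → ℕ → ℤ} {x : ℕ → ℤ} (h : QRel r n a x b)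
    (hj : Joint r n a x) {m : ℕ} (hm : m < n) (hI : Ilace r (fun i => a i m) (fun i => b i m)) :
    ∀ i ≤ r, XX a x b i m ≤ XX a x b i (m+1) := by
  intro i
  induction i with
  | zero => intro _; simpa [XX] using hj.xmono m hm
  | succ i ih =>
    intro hi
    have h1 := ih (by omega)
    have h2 := h.step i (by omega) m hm
    have h3 := hj.mono i (by omega) m hm
    have h4 := (hI i (by omega)).1
    simp only at h4
    rw [XX_succ, XX_succ]
    have := min_le_left (b i m + XX a x b i (m+1) - XX a x b i m) (a i (m+1))
    omega

theorem fwd_inter {r n : ℕ} {a b : ℕ → ℕ → ℤ} {x : ℕ → ℤ} (h : QRel r n a x b)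
    (hj : Joint r n a x) (hW : Wc r n a) :
    ∀ m ≤ n, Ilace r (fun i => a i m) (fun i => b i m) := by
  intro m
  induction m with
  | zero =>
    intro _ i hi
    have h0 := h.zero i hi
    have h1 := hj.zero i hi
    refine ⟨by simp only; omega, ?_⟩
    simp only
    by_cases hir : i + 1 < r
    · have h2 := h.zero _ hir
      have h3 := hj.zero _ hir
      omega
    · obtain rfl : i + 1 = r := by omega
      rw [h.last 0 (by omega), XX, Finset.sum_eq_zero, hj.xzero, h1]
      · simp
      · intro j hj'
        rw [h.zero j (by simpa using hj')]; ring
  | succ m ih =>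
    intro hm i hi
    have hI := ih (by omega)
    have hs := fwd_s h hj (by omega) hI
    have h2 := h.step i hi m (by omega)
    have h1 := hs i hi.le
    have hmn := hj.mono i hi m (by omega)
    refine ⟨by simp only; omega, ?_⟩
    have h4 := (hI i hi).2
    simp only at h4 ⊢
    have e1 := XX_succ a b x i m
    have e2 := XX_succ a b x i (m+1)
    by_cases hir : i + 1 < r
    · have h5 := h.step (i+1) hir m (by omega)
      have h6 := hW (m+1) hm i hir
      omega
    · obtain rfl : i + 1 = r := by omega
      have h5 := h.last (m+1) hm
      have h6 := h.last m (by omega)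
      omega

theorem fwd_path {r n : ℕ} {a b : ℕ → ℕ → ℤ} {x : ℕ → ℤ} (h : QRel r n a x b)
    (hj : Joint r n a x) (hW : Wc r n a) : PathOn (r+1) n b ∧ Wc (r+1) n b := by
  have hI := fwd_inter h hj hW
  refine ⟨⟨?_, ?_, ?_⟩, ?_⟩
  · intro i hi
    by_cases hir : i < r
    · rw [h.zero i hir, hj.zero i hir]
    · obtain rfl : i = r := by omega
      rw [h.last 0 (by omega), XX, Finset.sum_eq_zero, hj.xzero]
      · simp
      · intro j hj'
        rw [h.zero j (by simpa using hj')]; ring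
  · intro i hi m hm
    have hs := fwd_s h hj hm (hI m hm.le) i (by omega)
    by_cases hir : i < r
    · have h2 := h.step i hir m (by omega)
      have h3 := hj.mono i hir m hm
      have h4 := (hI m hm.le i hir).1
      simp only at h4
      omega
    · obtain rfl : i = r := by omega
      rw [h.last m hm.le, h.last (m+1) hm]
      exact hs
  · intro m hm
    rw [h.sum hm.le, h.sum (Nat.succ_le_of_lt hm)]
    exact hj.step m hm
  · intro m hm i hi
    have h1 := hI m hm i (by omega)
    exact h1.1.trans h1.2

theorem Joint.psum_le {r n : ℕ} {a : ℕ → ℕ → ℤ} {x : ℕ → ℤ} (hj : Joint r n a x)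
    {m : ℕ} (hm : m < n) {i : ℕ} (hi : i ≤ r) :
    ∑ j ∈ Finset.range i, (a j (m+1) - a j m) + (x (m+1) - x m) ≤ 1 := by
  have h1 := hj.step m hm
  have h2 : ∑ j ∈ Finset.range i, (a j (m+1) - a j m)
      ≤ ∑ j ∈ Finset.range r, (a j (m+1) - a j m) := by
    apply Finset.sum_le_sum_of_subset_of_nonneg
    · intro j; simp; omega
    · intro j hj1 _
      have := hj.mono j (by simpa using hj1) m hm
      omega
  rw [Finset.sum_sub_distrib (s := Finset.range r)] at h2
  omega

theorem uniq {r n : ℕ} {a a' b b' : ℕ → ℕ → ℤ} {x x' : ℕ → ℤ}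
    (h : QRel r n a x b) (hj : Joint r n a x) (hW : Wc r n a)
    (h' : QRel r n a' x' b') (hj' : Joint r n a' x') (hW' : Wc r n a')
    (hb : ∀ i < r+1, ∀ m ≤ n, b i m = b' i m)
    (ha : ∀ i < r, a i n = a' i n) :
    (∀ m ≤ n, ∀ i < r, a i m = a' i m) ∧ ∀ m ≤ n, x m = x' m := by
  have hI := fwd_inter h hj hW
  have hI' := fwd_inter h' hj' hW'
  have hbp := fwd_path h hj hW
  have key : ∀ m < n, (∀ i < r, a i (m+1) = a' i (m+1)) → ∀ i < r, a i m = a' i m := by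
    intro m hm hmm
    have hs := fwd_s h hj hm (hI m hm.le)
    have hs' := fwd_s h' hj' hm (hI' m hm.le)
    have main : ∀ d i, i + d = r →
        (XX a x b i (m+1) - XX a x b i m = XX a' x' b' i (m+1) - XX a' x' b' i m) ∧
        (i < r → a i m = a' i m) := by
      intro d
      induction d with
      | zero =>
        intro i hi
        obtain rfl : i = r := by omega
        refine ⟨?_, by omega⟩
        rw [← h.last m hm.le, ← h.last (m+1) hm, ← h'.last m hm.le, ← h'.last (m+1) hm,
          hb i (by omega) m hm.le, hb i (by omega) (m+1) hm]
      | succ d ih =>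
        intro i hi
        obtain ⟨e, -⟩ := ih (i+1) (by omega)
        rw [XX_succ, XX_succ, XX_succ, XX_succ] at e
        have hir : i < r := by omega
        have b1 := hb i (by omega) m hm.le
        have b2 := hb i (by omega) (m+1) hm
        have a1 := hmm i hir
        have s1 := h.step i hir m hm
        have s1' := h'.step i hir m hm
        have i1 := (hI m hm.le i hir).1
        have i1' := (hI' m hm.le i hir).1
        have m1 := hj.mono i hir m hm
        have m1' := hj'.mono i hir m hm
        have p1 := hs i hir.le
        have p1' := hs' i hir.le
        have bm := hbp.1.mono
        have q : (XX a x b i (m+1) - XX a x b i m) + (a i (m+1) - a i m) ≤ 1 := by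
          have := hj.psum_le hm (i := i+1) (by omega)
          have hnn : 0 ≤ ∑ j ∈ Finset.range i, (b j (m+1) - b j m) := by
            apply Finset.sum_nonneg
            intro j hj1
            have := bm j (by simp at hj1; omega) m hm
            omega
          rw [Finset.sum_range_succ] at this
          simp only [XX, Finset.sum_sub_distrib] at this hnn ⊢
          omega
        simp only at i1 i1'
        clear hs hs' hI hI' ih bm hbp
        omega
    intro i hi
    exact (main (r - i) i (by omega)).2 hi
  have A : ∀ d m, m + d = n → ∀ i < r, a i m = a' i m := by
    intro d
    induction d with
    | zero => intro m hm; obtain rfl : m = n := by omega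
              exact ha
    | succ d ih => intro m hm; exact key m (by omega) (ih (m+1) (by omega))
  have A' : ∀ m ≤ n, ∀ i < r, a i m = a' i m := fun m hm => A (n-m) m (by omega)
  refine ⟨A', ?_⟩
  intro m hm
  have e1 := h.sum hm
  have e2 := h'.sum hm
  have e3 : ∑ i ∈ Finset.range (r+1), b i m = ∑ i ∈ Finset.range (r+1), b' i m :=
    Finset.sum_congr rfl fun i hi => hb i (by simpa using hi) m hm
  have e4 : ∑ i ∈ Finset.range r, a i m = ∑ i ∈ Finset.range r, a' i m :=
    Finset.sum_congr rfl fun i hi => A' m hm i (by simpa using hi)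
  omega

/-- forward determinism -/
theorem rel_det {r n : ℕ} {a a' b b' : ℕ → ℕ → ℤ} {x x' : ℕ → ℤ}
    (h : QRel r n a x b) (h' : QRel r n a' x' b')
    (ha : ∀ i < r, ∀ m ≤ n, a i m = a' i m) (hx : ∀ m ≤ n, x m = x' m) :
    ∀ m ≤ n, ∀ i < r+1, b i m = b' i m := by
  have L : ∀ m ≤ n, (∀ i < r, b i m = b' i m) → ∀ i ≤ r, XX a x b i m = XX a' x' b' i m := by
    intro m hm hb i hi
    rw [XX, XX, hx m hm]
    congr 1
    apply Finset.sum_congr rfl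
    intro j hj
    simp at hj
    rw [ha j (by omega) m hm, hb j (by omega)]
  have A : ∀ m ≤ n, ∀ i < r, b i m = b' i m := by
    intro m
    induction m with
    | zero => intro _ i hi; rw [h.zero i hi, h'.zero i hi, ha i hi 0 (by omega)]
    | succ m ih =>
      intro hm
      have ihm := ih (by omega)
      intro i
      induction i using Nat.strong_induction_on with
      | _ i ihi =>
        intro hi
        rw [h.step i hi m (by omega), h'.step i hi m (by omega), ihm i hi,
          L m (by omega) ihm i hi.le, ha i hi (m+1) hm]
        have : XX a x b i (m+1) = XX a' x' b' i (m+1) := by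
          rw [XX, XX, hx (m+1) hm]
          congr 1
          apply Finset.sum_congr rfl
          intro j hj
          simp at hj
          rw [ha j (by omega) (m+1) hm, ihi j hj (by omega)]
        rw [this]
  intro m hm i hi
  by_cases hir : i < r
  · exact A m hm i hir
  · obtain rfl : i = r := by omega
    rw [h.last m hm, h'.last m hm, L m hm (A m hm) i le_rfl]

theorem unit_step (N : ℕ) (d : ℕ → ℤ) (h0 : ∀ i < N, 0 ≤ d i)
    (h1 : ∑ i ∈ Finset.range N, d i ≤ 1) :
    (∀ i < N, d i = 0) ∨ ∃ j < N, d j = 1 ∧ ∀ i < N, i ≠ j → d i = 0 := by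
  by_cases h : ∀ i < N, d i = 0
  · exact Or.inl h
  · right
    push Not at h
    obtain ⟨j, hj, hne⟩ := h
    have hs : d j + ∑ i ∈ (Finset.range N).erase j, d i = ∑ i ∈ Finset.range N, d i :=
      Finset.add_sum_erase _ _ (by simpa using hj)
    have hnn : ∀ i ∈ (Finset.range N).erase j, 0 ≤ d i := by
      intro i hi; simp at hi; exact h0 i hi.2
    have h2 := Finset.sum_nonneg hnn
    have h3 := h0 j hj
    refine ⟨j, hj, by omega, ?_⟩
    intro i hi hij
    have h4 := Finset.single_le_sum hnn (by simp [hi, hij] : i ∈ (Finset.range N).erase j)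
    have h5 := h0 i hi
    omega

/-- one step backwards -/
theorem back_step (r : ℕ) (b b' a' : ℕ → ℤ) (hW : ∀ i < r, b i ≤ b (i+1))
    (hmono : ∀ i < r+1, b i ≤ b' i)
    (hstep : ∑ i ∈ Finset.range (r+1), b' i ≤ ∑ i ∈ Finset.range (r+1), b i + 1)
    (hI : Ilace r a' b') :
    ∃ (a : ℕ → ℤ) (s : ℕ → ℤ), 0 ≤ s 0 ∧ (∀ i < r, a i ≤ a' i) ∧ Ilace r a b ∧
      (∀ i < r, s (i+1) = s i + (a' i - a i) - (b' i - b i)) ∧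
      (∀ i < r, b' i = min (b i + s i) (a' i)) ∧ b' r = b r + s r := by
  have hu := unit_step (r+1) (fun i => b' i - b i) (fun i hi => by have := hmono i hi; omega)
    (by rw [Finset.sum_sub_distrib]; omega)
  rcases hu with hz | ⟨j, hj, hj1, hz⟩
  · refine ⟨a', fun _ => 0, le_rfl, fun _ _ => le_rfl, ?_, ?_, ?_, ?_⟩
    · intro i hi
      have := hI i hi
      have := hz i (by omega)
      have := hz (i+1) (by omega)
      omega
    · intro i hi
      have := hz i (by omega)
      beta_reduce; omega
    · intro i hi
      have := hI i hi
      have := hz i (by omega)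
      beta_reduce; omega
    · have := hz r (by omega)
      beta_reduce; omega
  · by_cases hex : ∃ i, i < j ∧ b' i < a' i
    · obtain ⟨i0, hi0, hmax⟩ : ∃ i0, (i0 < j ∧ b' i0 < a' i0) ∧
          ∀ l, l < j → b' l < a' l → l ≤ i0 := by
        obtain ⟨i, hi⟩ := hex
        obtain ⟨i0, h1, h2⟩ := Finset.exists_max_image
          ((Finset.range j).filter (fun l => b' l < a' l)) id ⟨i, by simpa using hi⟩
        simp at h1 h2
        exact ⟨i0, h1, h2⟩
      refine ⟨fun l => if l = i0 then a' l - 1 else a' l,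
        fun l => if i0 < l ∧ l ≤ j then 1 else 0, by simp, ?_, ?_, ?_, ?_, ?_⟩
      · intro i hi
        simp only
        split_ifs <;> omega
      · intro i hi
        have h1 := hI i hi
        have h2 := hW i hi
        have h3 := hmax i
        have h4 : i ≠ j → b' i - b i = 0 := fun h => hz i (by omega) h
        have h5 : i + 1 ≠ j → b' (i+1) - b (i+1) = 0 := fun h => hz _ (by omega) h
        by_cases e1 : i = j
        · subst e1
          simp only
          split_ifs <;> omega
        · by_cases e2 : i + 1 = j
          · subst e2
            simp only
            split_ifs with e3
            · subst e3; omega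
            · omega
          · simp only
            split_ifs with e3
            · subst e3; omega
            · omega
      · intro i hi
        have h4 : i ≠ j → b' i - b i = 0 := fun h => hz i (by omega) h
        by_cases e1 : i = j
        · subst e1
          simp only at hj1 ⊢
          split_ifs <;> omega
        · simp only
          split_ifs <;> omega
      · intro i hi
        have h1 := hI i hi
        have h3 := hmax i
        have h4 : i ≠ j → b' i - b i = 0 := fun h => hz i (by omega) h
        by_cases e1 : i = j
        · subst e1
          simp only at hj1 ⊢
          split_ifs <;> omega
        · simp only
          split_ifs <;> omega
      · have h4 : r ≠ j → b' r - b r = 0 := fun h => hz r (by omega) h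
        by_cases e1 : r = j
        · subst e1
          simp only at hj1 ⊢
          split_ifs <;> omega
        · simp only
          split_ifs <;> omega
    · push Not at hex
      refine ⟨a', fun l => if l ≤ j then 1 else 0, by simp, fun _ _ => le_rfl, ?_, ?_, ?_, ?_⟩
      · intro i hi
        have h1 := hI i hi
        have h2 := hW i hi
        have h3 := hex i
        have h4 : i ≠ j → b' i - b i = 0 := fun h => hz i (by omega) h
        have h5 : i + 1 ≠ j → b' (i+1) - b (i+1) = 0 := fun h => hz _ (by omega) h
        by_cases e1 : i = j
        · subst e1
          omega
        · by_cases e2 : i + 1 = j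
          · subst e2
            omega
          · omega
      · intro i hi
        have h4 : i ≠ j → b' i - b i = 0 := fun h => hz i (by omega) h
        by_cases e1 : i = j
        · subst e1
          simp only at hj1 ⊢
          split_ifs <;> omega
        · simp only
          split_ifs <;> omega
      · intro i hi
        have h1 := hI i hi
        have h3 := hex i
        have h4 : i ≠ j → b' i - b i = 0 := fun h => hz i (by omega) h
        by_cases e1 : i = j
        · subst e1
          simp only at hj1 ⊢
          split_ifs <;> omega
        · simp only
          split_ifs <;> omega
      · have h4 : r ≠ j → b' r - b r = 0 := fun h => hz r (by omega) h
        by_cases e1 : r = j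
        · subst e1
          simp only at hj1 ⊢
          split_ifs <;> omega
        · simp only
          split_ifs <;> omega

/-- the one step backward relation -/
def BStep (r : ℕ) (b b' a a' : ℕ → ℤ) : Prop :=
  ∃ s : ℕ → ℤ, 0 ≤ s 0 ∧ (∀ i < r, a i ≤ a' i) ∧
      (∀ i < r, s (i+1) = s i + (a' i - a i) - (b' i - b i)) ∧
      (∀ i < r, b' i = min (b i + s i) (a' i)) ∧ b' r = b r + s r

theorem BStep.congr_a {r : ℕ} {b b' a a' c c' : ℕ → ℤ} (h : BStep r b b' a a')
    (h1 : ∀ i < r, c i = a i) (h2 : ∀ i < r, c' i = a' i) : BStep r b b' c c' := by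
  obtain ⟨s, hs0, hs1, hs2, hs3, hs4⟩ := h
  refine ⟨s, hs0, ?_, ?_, ?_, hs4⟩
  · intro i hi; rw [h1 i hi, h2 i hi]; exact hs1 i hi
  · intro i hi; rw [h1 i hi, h2 i hi]; exact hs2 i hi
  · intro i hi; rw [h2 i hi]; exact hs3 i hi

theorem back_path (r : ℕ) (b : ℕ → ℕ → ℤ) : ∀ (n : ℕ), PathOn (r+1) n b → Wc (r+1) n b →
    ∀ α : ℕ → ℤ, Ilace r α (fun i => b i n) →
    ∃ a : ℕ → ℕ → ℤ, (∀ i < r, a i n = α i) ∧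
      (∀ m ≤ n, Ilace r (fun i => a i m) (fun i => b i m)) ∧
      (∀ m < n, BStep r (fun i => b i m) (fun i => b i (m+1))
        (fun i => a i m) (fun i => a i (m+1))) := by
  intro n
  induction n with
  | zero =>
    intro _ _ α hα
    refine ⟨fun i _ => α i, fun _ _ => rfl, ?_, by simp⟩
    intro m hm
    obtain rfl : m = 0 := by omega
    exact hα
  | succ n ih =>
    intro hP hW α hα
    obtain ⟨a0, s, h1, h2, h3, h4, h5, h6⟩ := back_step r (fun i => b i n) (fun i => b i (n+1)) α
      (fun i hi => hW n (by omega) i (by omega)) (fun i hi => hP.mono i hi n (by omega))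
      (hP.step n (by omega)) hα
    obtain ⟨a, ha1, ha2, ha3⟩ := ih
      ⟨hP.zero, fun i hi m hm => hP.mono i hi m (by omega), fun m hm => hP.step m (by omega)⟩
      (fun m hm => hW m (by omega)) a0 h3
    refine ⟨fun i m => if m ≤ n then a i m else α i, ?_, ?_, ?_⟩
    · intro i hi; simp
    · intro m hm
      by_cases hmn : m ≤ n
      · simpa [hmn] using ha2 m hmn
      · obtain rfl : m = n + 1 := by omega
        simpa using hα
    · intro m hm
      by_cases hmn : m < n
      · have e1 : m ≤ n := by omega
        have e2 : m + 1 ≤ n := by omega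
        simpa [e1, e2] using ha3 m hmn
      · obtain rfl : m = n := by omega
        have hB : BStep r (fun i => b i m) (fun i => b i (m+1)) a0 α := ⟨s, h1, h2, h4, h5, h6⟩
        apply hB.congr_a
        · intro i hi; simp [ha1 i hi]
        · intro i hi; simp

theorem back_full (r n : ℕ) (b : ℕ → ℕ → ℤ) (hP : PathOn (r+1) n b) (hW : Wc (r+1) n b)
    (α : ℕ → ℤ) (hα : Ilace r α (fun i => b i n)) :
    ∃ (a : ℕ → ℕ → ℤ) (x : ℕ → ℤ), (∀ i < r, a i n = α i) ∧ QRel r n a x b ∧ Joint r n a x ∧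
      Wc r n a := by
  obtain ⟨a, h1, h2, h3⟩ := back_path r b n hP hW α hα
  set x : ℕ → ℤ := fun m => ∑ i ∈ Finset.range (r+1), b i m - ∑ i ∈ Finset.range r, a i m with hx
  have hlast : ∀ m, b r m = XX a x b r m := by
    intro m
    simp only [XX, hx, Finset.sum_range_succ, Finset.sum_sub_distrib]
    ring
  have ha0 : ∀ i < r, a i 0 = 0 := by
    intro i hi
    have e1 := h2 0 (by omega) i hi
    have e2 := hP.zero i (by omega)
    have e3 := hP.zero (i+1) (by omega)
    simp only at e1
    omega
  have hs : ∀ m < n, ∃ s : ℕ → ℤ, 0 ≤ s 0 ∧ (∀ i < r, a i m ≤ a i (m+1)) ∧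
      (∀ i < r, b i (m+1) = min (b i m + s i) (a i (m+1))) ∧
      (∀ i ≤ r, s i = XX a x b i (m+1) - XX a x b i m) := by
    intro m hm
    obtain ⟨s, hs0, hs1, hs2, hs3, hs4⟩ := h3 m hm
    refine ⟨s, hs0, hs1, hs3, ?_⟩
    have : ∀ d i, i + d = r → s i = XX a x b i (m+1) - XX a x b i m := by
      intro d
      induction d with
      | zero =>
        intro i hi
        obtain rfl : i = r := by omega
        rw [← hlast, ← hlast]
        beta_reduce at hs4; omega
      | succ d ih =>
        intro i hi
        have e := ih (i+1) (by omega)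
        rw [XX_succ, XX_succ] at e
        have := hs2 i (by omega)
        simp only at this
        omega
    intro i hi
    exact this (r-i) i (by omega)
  refine ⟨a, x, h1, ⟨?_, ?_, ?_⟩, ⟨ha0, ?_, ?_, ?_, ?_⟩, ?_⟩
  · intro i hi
    rw [hP.zero i (by omega), ha0 i hi]
  · intro i hi m hm
    obtain ⟨s, -, -, e1, e2⟩ := hs m hm
    rw [e1 i hi, e2 i hi.le]
    congr 1; ring
  · intro m _; exact hlast m
  · intro i hi m hm
    obtain ⟨s, -, e, -⟩ := hs m hm
    exact e i hi
  · simp only [hx]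
    rw [Finset.sum_eq_zero, Finset.sum_eq_zero]
    · simp
    · intro i hi; exact ha0 i (by simpa using hi)
    · intro i hi; exact hP.zero i (by simpa using hi)
  · intro m hm
    obtain ⟨s, e0, -, -, e⟩ := hs m hm
    have := e 0 (by omega)
    simp [XX] at this
    omega
  · intro m hm
    have := hP.step m hm
    simp only [hx]
    omega
  · intro m hm i hi
    have e1 := h2 m hm i (by omega)
    have e2 := h2 m hm (i+1) (by omega)
    simp only at e1 e2
    omega

theorem PathOn.pre {r n : ℕ} {x : ℕ → ℕ → ℤ} (h : PathOn (r+1) n x) : PathOn r n x := by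
  refine ⟨fun i hi => h.zero i (by omega), fun i hi => h.mono i (by omega), ?_⟩
  intro m hm
  have h1 := h.step m hm
  have h2 := h.mono r (by omega) m hm
  rw [Finset.sum_range_succ, Finset.sum_range_succ] at h1
  omega

theorem G_all (n : ℕ) (x : ℕ → ℕ → ℤ) : ∀ k, PathOn k n x →
    PathOn k n (G k x) ∧ Wc k n (G k x) ∧
    ∀ m ≤ n, ∑ i ∈ Finset.range k, G k x i m = ∑ i ∈ Finset.range k, x i m := by
  intro k
  induction k with
  | zero =>
    intro h
    refine ⟨h, ?_, ?_⟩
    · intro m hm i hi; omega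
    · intro m hm; simp
  | succ k ih =>
    intro h
    obtain ⟨h1, h2, h3⟩ := ih h.pre
    have hR := G_rel k n x
    have hJ : Joint k n (G k x) (x k) := by
      refine ⟨h1.zero, h1.mono, h.zero k (by omega), h.mono k (by omega), ?_⟩
      intro m hm
      rw [h3 m hm.le, h3 (m+1) hm, ← Finset.sum_range_succ (fun i => x i (m+1)),
        ← Finset.sum_range_succ (fun i => x i m)]
      exact h.step m hm
    obtain ⟨e1, e2⟩ := fwd_path hR hJ h2
    refine ⟨e1, e2, ?_⟩
    intro m hm
    rw [hR.sum hm, h3 m hm, Finset.sum_range_succ]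

theorem G_joint {n k : ℕ} {x : ℕ → ℕ → ℤ} (h : PathOn (k+1) n x) :
    Joint k n (G k x) (x k) := by
  obtain ⟨h1, h2, h3⟩ := G_all n x k h.pre
  refine ⟨h1.zero, h1.mono, h.zero k (by omega), h.mono k (by omega), ?_⟩
  intro m hm
  rw [h3 m hm.le, h3 (m+1) hm, ← Finset.sum_range_succ (fun i => x i (m+1)),
    ← Finset.sum_range_succ (fun i => x i m)]
  exact h.step m hm

theorem PathOn.le {n : ℕ} {x : ℕ → ℕ → ℤ} {r k : ℕ} (hrk : r ≤ k) (h : PathOn k n x) :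
    PathOn r n x := by
  induction k with
  | zero => obtain rfl : r = 0 := by omega
            exact h
  | succ k ih =>
    by_cases e : r = k + 1
    · subst e; exact h
    · exact ih (by omega) h.pre

theorem G_inter {n k : ℕ} {x : ℕ → ℕ → ℤ} (h : PathOn k n x) {r : ℕ} (hr : r < k) :
    ∀ m ≤ n, Ilace r (fun i => G r x i m) (fun i => G (r+1) x i m) :=
  fwd_inter (G_rel r n x) (G_joint (h.le hr)) (G_all n x r (h.le hr.le)).2.1

theorem G_congr {n : ℕ} {x x' : ℕ → ℕ → ℤ} : ∀ k, (∀ i < k, ∀ m ≤ n, x i m = x' i m) →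
    ∀ m ≤ n, ∀ i < k, G k x i m = G k x' i m := by
  intro k
  induction k with
  | zero => intro _ m _ i hi; omega
  | succ k ih =>
    intro h
    have := ih (fun i hi => h i (by omega))
    exact rel_det (G_rel k n x) (G_rel k n x') (fun i hi m hm => this m hm i hi)
      (fun m hm => h k (by omega) m hm)

theorem G_uniq {n : ℕ} {x x' : ℕ → ℕ → ℤ} : ∀ k, PathOn k n x → PathOn k n x' →
    (∀ i < k, ∀ m ≤ n, G k x i m = G k x' i m) →
    (∀ r ≤ k, ∀ i < r, G r x i n = G r x' i n) →
    ∀ i < k, ∀ m ≤ n, x i m = x' i m := by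
  intro k
  induction k with
  | zero => intro _ _ _ _ i hi; omega
  | succ k ih =>
    intro h h' hG hr
    obtain ⟨e1, e2⟩ := uniq (G_rel k n x) (G_joint h) (G_all n x k h.pre).2.1
      (G_rel k n x') (G_joint h') (G_all n x' k h'.pre).2.1 hG (hr k (by omega))
    have := ih h.pre h'.pre (fun i hi m hm => e1 m hm i hi) (fun r hr' => hr r (by omega))
    intro i hi
    by_cases hik : i < k
    · exact this i hik
    · obtain rfl : i = k := by omega
      exact e2

theorem G_exists {n : ℕ} : ∀ (k : ℕ) (g : ℕ → ℕ → ℤ), PathOn k n g → Wc k n g →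
    ∀ z : ℕ → ℕ → ℤ, (∀ i < k, z k i = g i n) → (∀ r < k, Ilace r (z r) (z (r+1))) →
    ∃ x, PathOn k n x ∧ (∀ m ≤ n, ∀ i < k, G k x i m = g i m) ∧
      ∀ r ≤ k, ∀ i < r, G r x i n = z r i := by
  intro k
  induction k with
  | zero =>
    intro g hg _ z _ _
    exact ⟨g, hg, fun _ _ i hi => by omega, fun r hr i hi => by omega⟩
  | succ k ih =>
    intro g hg hW z hz hI
    have hIk : Ilace k (z k) (fun i => g i n) := by
      intro i hi
      have := hI k (by omega) i hi
      rw [hz i (by omega), hz (i+1) (by omega)] at this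
      exact this
    obtain ⟨a, xk, h1, h2, h3, h4⟩ := back_full k n g hg hW (z k) hIk
    have haP : PathOn k n a := by
      refine ⟨h3.zero, h3.mono, ?_⟩
      intro m hm
      have := h3.step m hm
      have := h3.xmono m hm
      omega
    obtain ⟨x, x1, x2, x3⟩ := ih a haP h4 z (fun i hi => (h1 i hi).symm)
      (fun r hr => hI r (by omega))
    set x' : ℕ → ℕ → ℤ := fun i => if i = k then xk else x i with hx'
    have hx : ∀ i < k, x' i = x i := by
      intro i hi
      simp [hx', show i ≠ k by omega]
    have hxk : x' k = xk := by simp [hx']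
    have hc : ∀ r ≤ k, ∀ m ≤ n, ∀ i < r, G r x' i m = G r x i m := by
      intro r hr
      apply G_congr
      intro i hi m _
      rw [hx i (by omega)]
    have hG : ∀ m ≤ n, ∀ i < k+1, G (k+1) x' i m = g i m := by
      apply rel_det (G_rel k n x') h2
      · intro i hi m hm
        rw [hc k le_rfl m hm i hi, x2 m hm i hi]
      · intro m _; rw [hxk]
    have hsum : ∀ m ≤ n, ∑ i ∈ Finset.range (k+1), x' i m
        = ∑ i ∈ Finset.range k, a i m + xk m := by
      intro m hm
      rw [Finset.sum_range_succ, hxk]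
      congr 1
      rw [Finset.sum_congr rfl (fun i hi => by rw [hx i (by simpa using hi)]),
        ← (G_all n x k x1).2.2 m hm]
      exact Finset.sum_congr rfl (fun i hi => x2 m hm i (by simpa using hi))
    refine ⟨x', ⟨?_, ?_, ?_⟩, hG, ?_⟩
    · intro i hi
      by_cases hik : i < k
      · rw [hx i hik]; exact x1.zero i hik
      · obtain rfl : i = k := by omega
        rw [hxk]; exact h3.xzero
    · intro i hi
      by_cases hik : i < k
      · rw [hx i hik]; exact x1.mono i hik
      · obtain rfl : i = k := by omega
        rw [hxk]; exact h3.xmono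
    · intro m hm
      rw [hsum m hm.le, hsum (m+1) hm]
      exact h3.step m hm
    · intro r hr i hi
      by_cases hrk : r ≤ k
      · rw [hc r hrk n le_rfl i hi, x3 r hrk i hi]
      · obtain rfl : r = k + 1 := by omega
        rw [hG n le_rfl i hi, hz i hi]

structure IsGT (k : ℕ) (L : ℕ → ℕ → ℕ) : Prop where
  zero : ∀ r ≤ k, ∀ ρ, r ≤ ρ → L r ρ = 0
  lo : ∀ r < k, ∀ ρ, L (r+1) (ρ+1) ≤ L r ρ
  hi : ∀ r < k, ∀ ρ, L r ρ ≤ L (r+1) ρ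

structure TRep (k : ℕ) (L : ℕ → ℕ → ℕ) (T : ℕ → ℕ → ℕ) : Prop where
  out : ∀ ρ c, ¬ c < L k ρ → T ρ c = 0
  iff : ∀ ρ c, c < L k ρ → ∀ r ≤ k, (T ρ c < r ↔ c < L r ρ)

theorem IsGT.mono {k : ℕ} {L : ℕ → ℕ → ℕ} (h : IsGT k L) (ρ : ℕ) :
    ∀ s r, r ≤ s → s ≤ k → L r ρ ≤ L s ρ := by
  intro s
  induction s with
  | zero => intro r hr _; obtain rfl : r = 0 := by omega
            exact le_rfl
  | succ s ih =>
    intro r hr hs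
    by_cases e : r = s + 1
    · subst e; exact le_rfl
    · exact (ih r (by omega) (by omega)).trans (h.hi s (by omega) ρ)

theorem IsGT.diag {k : ℕ} {L : ℕ → ℕ → ℕ} (h : IsGT k L) {r ρ ρ' : ℕ} (hr : r < k)
    (hρ : ρ < ρ') : L (r+1) ρ' ≤ L r ρ := by
  induction ρ', hρ using Nat.le_induction with
  | base => exact h.lo r hr ρ
  | succ m hm ih => exact ((h.lo r hr m).trans (h.hi r hr m)).trans ih

def Tab (k : ℕ) (L : ℕ → ℕ → ℕ) : ℕ → ℕ → ℕ := fun ρ c =>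
  if c < L k ρ then ((Finset.range k).filter (fun r => L (r+1) ρ ≤ c)).card else 0

theorem tab_rep {k : ℕ} {L : ℕ → ℕ → ℕ} (h : IsGT k L) : TRep k L (Tab k L) := by
  refine ⟨fun ρ c hc => by simp [Tab, hc], ?_⟩
  intro ρ c hc r hr
  rw [Tab, if_pos hc]
  constructor
  · intro hlt
    by_contra hcon
    have : Finset.range r ⊆ (Finset.range k).filter (fun r => L (r+1) ρ ≤ c) := by
      intro i hi
      simp only [Finset.mem_range, Finset.mem_filter] at hi ⊢
      have := h.mono ρ r (i+1) (by omega) hr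
      omega
    have := Finset.card_le_card this
    simp only [Finset.card_range] at this
    omega
  · intro hlt
    have hr0 : r ≠ 0 := by
      rintro rfl
      have := h.zero 0 (by omega) ρ (by omega)
      omega
    have : (Finset.range k).filter (fun r => L (r+1) ρ ≤ c) ⊆ Finset.range (r-1) := by
      intro i hi
      simp only [Finset.mem_range, Finset.mem_filter] at hi ⊢
      by_contra hcon
      have := h.mono ρ (i+1) r (by omega) (by omega)
      omega
    have := Finset.card_le_card this
    simp only [Finset.card_range] at this
    omega

theorem rep_ssyt {k : ℕ} {L T : ℕ → ℕ → ℕ} (h : IsGT k L) (hT : TRep k L T) :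
    IsSSYT k (L k) T := by
  refine ⟨?_, hT.out, ?_, ?_⟩
  · intro r c hc
    exact (hT.iff r c hc k le_rfl).2 hc
  · intro ρ c c' hcc hc
    have h1 : T ρ c' < k := (hT.iff ρ c' hc k le_rfl).2 hc
    have h2 := (hT.iff ρ c' hc (T ρ c' + 1) (by omega)).1 (by omega)
    have h3 := (hT.iff ρ c (by omega) (T ρ c' + 1) (by omega)).2 (by omega)
    omega
  · intro ρ ρ' c hρ hc
    have h1 : T ρ' c < k := (hT.iff ρ' c hc k le_rfl).2 hc
    have h2 := (hT.iff ρ' c hc (T ρ' c + 1) (by omega)).1 (by omega)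
    have h3 := h.diag h1 hρ
    have h4 := h.mono ρ k (T ρ' c) (by omega) le_rfl
    exact (hT.iff ρ c (by omega) (T ρ' c) (by omega)).2 (by omega)

theorem mem_cells {k : ℕ} {lam : ℕ → ℕ} {q : ℕ × ℕ} :
    q ∈ cells k lam ↔ q.1 < k ∧ q.2 < lam q.1 := by
  simp only [cells, Finset.mem_filter, Finset.mem_product, Finset.mem_range]
  constructor
  · rintro ⟨⟨h1, _⟩, h2⟩; exact ⟨h1, h2⟩
  · rintro ⟨h1, h2⟩
    refine ⟨⟨h1, lt_of_lt_of_le h2 ?_⟩, h2⟩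
    exact Finset.le_sup (f := lam) (by simpa using h1)

theorem sum_entryCount (k : ℕ) (lam : ℕ → ℕ) (T : ℕ → ℕ → ℕ) (r : ℕ) :
    ∑ i ∈ Finset.range r, entryCount k lam T i
      = ((cells k lam).filter (fun q => T q.1 q.2 < r)).card := by
  rw [Finset.card_eq_sum_card_fiberwise (f := fun q : ℕ × ℕ => T q.1 q.2) (t := Finset.range r)]
  · apply Finset.sum_congr rfl
    intro i hi
    simp only [Finset.mem_range] at hi
    rw [entryCount, Finset.filter_filter]
    congr 1
    apply Finset.filter_congr
    intro q _
    constructor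
    · intro e; exact ⟨by omega, e⟩
    · intro e; exact e.2
  · intro q hq
    simp at hq ⊢
    exact hq.2

theorem rep_count {k : ℕ} {L T : ℕ → ℕ → ℕ} (h : IsGT k L) (hT : TRep k L T) {r : ℕ}
    (hr : r ≤ k) :
    ∑ i ∈ Finset.range r, entryCount k (L k) T i = ∑ ρ ∈ Finset.range k, L r ρ := by
  rw [sum_entryCount, Finset.card_eq_sum_card_fiberwise (f := Prod.fst) (t := Finset.range k)]
  · apply Finset.sum_congr rfl
    intro ρ hρ
    simp only [Finset.mem_range] at hρ
    have : ((cells k (L k)).filter (fun q => T q.1 q.2 < r)).filter (fun q => q.1 = ρ)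
        = (Finset.range (L r ρ)).image (fun c => (ρ, c)) := by
      ext ⟨a, c⟩
      simp only [Finset.mem_filter, mem_cells, Finset.mem_image, Finset.mem_range, Prod.mk.injEq]
      constructor
      · rintro ⟨⟨⟨h1, h2⟩, h3⟩, rfl⟩
        exact ⟨c, (hT.iff a c h2 r hr).1 h3, rfl, rfl⟩
      · rintro ⟨c', h1, rfl, rfl⟩
        have h2 := h.mono ρ k r hr le_rfl
        exact ⟨⟨⟨hρ, by omega⟩, (hT.iff ρ c' (by omega) r hr).2 h1⟩, rfl⟩
    rw [this, Finset.card_image_of_injective, Finset.card_range]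
    intro c c' hc
    simpa using hc
  · intro q hq
    simp [mem_cells] at hq ⊢
    exact hq.1.1

theorem of_ssyt {k : ℕ} {lam : ℕ → ℕ} {T : ℕ → ℕ → ℕ} (hT : IsSSYT k lam T)
    (hanti : ∀ ρ, lam (ρ+1) ≤ lam ρ) :
    ∃ L, IsGT k L ∧ TRep k L T ∧ L k = lam := by
  obtain ⟨h1, h2, h3, h4⟩ := hT
  have key : ∀ r ρ c, c < ((Finset.range (lam ρ)).filter (fun c => T ρ c < r)).card ↔
      c < lam ρ ∧ T ρ c < r := by
    intro r ρ c
    constructor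
    · intro hlt
      by_contra hcon
      have : (Finset.range (lam ρ)).filter (fun c => T ρ c < r) ⊆ Finset.range c := by
        intro d hd
        simp only [Finset.mem_range, Finset.mem_filter] at hd ⊢
        by_contra hdc
        have := h3 ρ c d (by omega) hd.1
        omega
      have := Finset.card_le_card this
      simp only [Finset.card_range] at this
      omega
    · rintro ⟨hc, hr⟩
      have : Finset.range (c+1) ⊆ (Finset.range (lam ρ)).filter (fun c => T ρ c < r) := by
        intro d hd
        simp only [Finset.mem_range, Finset.mem_filter] at hd ⊢
        have := h3 ρ d c (by omega) hc
        omega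
      have := Finset.card_le_card this
      simp only [Finset.card_range] at this
      omega
  have hle : ∀ {a b : ℕ}, (∀ c, c < a → c < b) → a ≤ b := by
    intro a b hab
    by_contra hcon
    have := hab b (by omega)
    omega
  set L : ℕ → ℕ → ℕ := fun r ρ => ((Finset.range (lam ρ)).filter (fun c => T ρ c < r)).card
    with hL
  have key' : ∀ r ρ c, c < L r ρ ↔ c < lam ρ ∧ T ρ c < r := key
  have hk : L k = lam := by
    funext ρ
    apply le_antisymm
    · exact hle fun c hc => ((key' _ _ _).1 hc).1
    · exact hle fun c hc => (key' _ _ _).2 ⟨hc, h1 ρ c hc⟩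
  have hge : ∀ ρ c, c < lam ρ → ρ ≤ T ρ c := by
    intro ρ
    induction ρ with
    | zero => intros; omega
    | succ ρ ih =>
      intro c hc
      have := ih c (lt_of_lt_of_le hc (hanti ρ))
      have := h4 ρ (ρ+1) c (by omega) hc
      omega
  refine ⟨L, ⟨?_, ?_, ?_⟩, ⟨?_, ?_⟩, hk⟩
  · intro r _ ρ hρ
    have : L r ρ ≤ 0 := hle fun c hc => by
      have e := (key' _ _ _).1 hc
      have := hge ρ c e.1
      omega
    omega
  · intro r _ ρ
    refine hle fun c hc => ?_
    have e := (key' _ _ _).1 hc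
    have := h4 ρ (ρ+1) c (by omega) e.1
    exact (key' _ _ _).2 ⟨lt_of_lt_of_le e.1 (hanti ρ), by omega⟩
  · intro r _ ρ
    refine hle fun c hc => ?_
    have e := (key' _ _ _).1 hc
    exact (key' _ _ _).2 ⟨e.1, by omega⟩
  · rw [hk]; exact h2
  · intro ρ c hc r _
    rw [hk] at hc
    rw [key']
    exact ⟨fun e => ⟨hc, e⟩, fun e => e.2⟩

theorem rep_unique {k : ℕ} {L T T' : ℕ → ℕ → ℕ} (h : TRep k L T) (h' : TRep k L T') : T = T' := by
  funext ρ c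
  by_cases hc : c < L k ρ
  · have e1 : T ρ c < k := (h.iff ρ c hc k le_rfl).2 hc
    have e2 : T' ρ c < k := (h'.iff ρ c hc k le_rfl).2 hc
    have e3 := (h'.iff ρ c hc (T ρ c + 1) (by omega)).2
      ((h.iff ρ c hc (T ρ c + 1) (by omega)).1 (by omega))
    have e4 := (h.iff ρ c hc (T' ρ c + 1) (by omega)).2
      ((h'.iff ρ c hc (T' ρ c + 1) (by omega)).1 (by omega))
    omega
  · rw [h.out ρ c hc, h'.out ρ c hc]

theorem rep_inj {k : ℕ} {L L' T : ℕ → ℕ → ℕ} (hL : IsGT k L) (hL' : IsGT k L')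
    (h : TRep k L T) (h' : TRep k L' T) (hk : L k = L' k) {r : ℕ} (hr : r ≤ k) (ρ : ℕ) :
    L r ρ = L' r ρ := by
  have m1 := hL.mono ρ k r hr le_rfl
  have m2 := hL'.mono ρ k r hr le_rfl
  rw [← hk] at m2
  rcases lt_trichotomy (L r ρ) (L' r ρ) with hlt | heq | hlt
  · have e := (h'.iff ρ (L r ρ) (by rw [← hk]; omega) r hr).2 hlt
    have := (h.iff ρ (L r ρ) (by omega) r hr).1 e
    omega
  · exact heq
  · have e := (h.iff ρ (L' r ρ) (by omega) r hr).2 hlt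
    have := (h'.iff ρ (L' r ρ) (by rw [← hk]; omega) r hr).1 e
    omega

theorem PathOn.nonneg {r n : ℕ} {x : ℕ → ℕ → ℤ} (h : PathOn r n x) {i : ℕ} (hi : i < r) :
    ∀ m ≤ n, 0 ≤ x i m := by
  intro m
  induction m with
  | zero => intro _; rw [h.zero i hi]
  | succ m ih => intro hm; exact (ih (by omega)).trans (h.mono i hi m (by omega))

theorem gt_of_path {k n : ℕ} {x : ℕ → ℕ → ℤ} (h : PathOn k n x) :
    IsGT k (fun r => revPartZ r (fun i => G r x i n)) := by
  refine ⟨?_, ?_, ?_⟩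
  · intro r _ ρ hρ
    simp [revPartZ, show ¬ ρ < r by omega]
  · intro r hr ρ
    simp only [revPartZ]
    split_ifs with h1 h2
    · have := (G_inter h hr n le_rfl (r-1-ρ) (by omega)).1
      simp only at this
      rw [show r + 1 - 1 - (ρ+1) = r - 1 - ρ by omega]
      exact Int.toNat_le_toNat this
    · omega
    · omega
    · omega
  · intro r hr ρ
    simp only [revPartZ]
    split_ifs with h1 h2
    · have := (G_inter h hr n le_rfl (r-1-ρ) (by omega)).2
      simp only at this
      rw [show r + 1 - 1 - ρ = r - 1 - ρ + 1 by omega]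
      exact Int.toNat_le_toNat this
    · omega
    · omega
    · omega

theorem rev_sum {k r : ℕ} (hr : r ≤ k) (v : ℕ → ℤ) (hv : ∀ i < r, 0 ≤ v i) :
    ((∑ ρ ∈ Finset.range k, revPartZ r v ρ : ℕ) : ℤ) = ∑ i ∈ Finset.range r, v i := by
  rw [← Finset.sum_range_reflect v r]
  push_cast
  rw [← Finset.sum_subset (Finset.range_mono hr)]
  · apply Finset.sum_congr rfl
    intro i hi
    simp only [Finset.mem_range] at hi
    rw [revPartZ, if_pos hi, Int.toNat_of_nonneg (hv _ (by omega))]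
  · intro i _ hi
    simp only [Finset.mem_range] at hi
    simp [revPartZ, hi]

/-- counting walk of a deterministic word -/
def wx (w : ℕ → ℕ) (i m : ℕ) : ℤ := (((Finset.range m).filter (fun l => w l = i)).card : ℤ)

def wext {n k : ℕ} (w : Fin n → Fin k) : ℕ → ℕ := fun m => if h : m < n then (w ⟨m, h⟩ : ℕ) else 0

theorem wx_succ (w : ℕ → ℕ) (i m : ℕ) : wx w i (m+1) = wx w i m + if w m = i then 1 else 0 := by
  simp only [wx, Finset.range_add_one, Finset.filter_insert]
  split_ifs with h
  · rw [Finset.card_insert_of_notMem (by simp)]; push_cast; rfl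
  · simp

theorem wx_sum_succ (w : ℕ → ℕ) (k m : ℕ) : ∑ i ∈ Finset.range k, wx w i (m+1)
    = ∑ i ∈ Finset.range k, wx w i m + if w m < k then 1 else 0 := by
  simp only [wx_succ, Finset.sum_add_distrib, Finset.sum_ite_eq, Finset.mem_range]

theorem wx_path (w : ℕ → ℕ) (k n : ℕ) : PathOn k n (wx w) := by
  refine ⟨fun i _ => by simp [wx], ?_, ?_⟩
  · intro i _ m _
    rw [wx_succ]; split_ifs <;> omega
  · intro m _
    rw [wx_sum_succ]; split_ifs <;> omega

theorem wx_sum_le (w : ℕ → ℕ) (k n : ℕ) : ∑ i ∈ Finset.range k, wx w i n ≤ n := by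
  induction n with
  | zero => simp [wx]
  | succ n ih => rw [wx_sum_succ]; push_cast; split_ifs <;> omega

theorem wx_full (w : ℕ → ℕ) (k n : ℕ) (h : ∑ i ∈ Finset.range k, wx w i n = n) :
    ∀ m < n, w m < k := by
  induction n with
  | zero => intro m hm; omega
  | succ n ih =>
    rw [wx_sum_succ] at h
    have := wx_sum_le w k n
    intro m hm
    split_ifs at h with hw
    · by_cases e : m = n
      · subst e; exact hw
      · exact ih (by push_cast at h; omega) m (by omega)
    · push_cast at h; omega

theorem wx_congr {w w' : ℕ → ℕ} {n : ℕ} (h : ∀ m < n, w m = w' m) (i : ℕ) :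
    ∀ m ≤ n, wx w i m = wx w' i m := by
  intro m hm
  rw [wx, wx]
  congr 2
  apply Finset.filter_congr
  intro l hl
  simp only [Finset.mem_range] at hl
  rw [h l (by omega)]

theorem word_exists {k n : ℕ} {x : ℕ → ℕ → ℤ} (h : PathOn k n x)
    (hs : ∀ m ≤ n, ∑ i ∈ Finset.range k, x i m = m) :
    ∃ w : Fin n → Fin k, ∀ i < k, ∀ m ≤ n, wx (wext w) i m = x i m := by
  have H : ∀ m : Fin n, ∃ j : Fin k, ∀ i < k,
      x i (m+1) = x i m + if (j : ℕ) = i then 1 else 0 := by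
    rintro ⟨m, hm⟩
    have e1 := hs m hm.le
    have e2 := hs (m+1) hm
    push_cast at e2
    rcases unit_step k (fun i => x i (m+1) - x i m)
      (fun i hi => by have := h.mono i hi m hm; omega)
      (by rw [Finset.sum_sub_distrib]; omega) with hz | ⟨j, hj, hj1, hz⟩
    · exfalso
      have : ∑ i ∈ Finset.range k, (x i (m+1) - x i m) = 0 :=
        Finset.sum_eq_zero fun i hi => hz i (by simpa using hi)
      rw [Finset.sum_sub_distrib] at this
      omega
    · refine ⟨⟨j, hj⟩, fun i hi => ?_⟩
      simp only
      split_ifs with e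
      · subst e; omega
      · have := hz i hi (Ne.symm e); omega
  choose w hw using H
  refine ⟨w, fun i hi m => ?_⟩
  induction m with
  | zero => intro _; rw [h.zero i hi]; simp [wx]
  | succ m ih =>
    intro hm
    have := hw ⟨m, by omega⟩ i hi
    simp only at this
    rw [wx_succ, ih (by omega), this]
    simp [wext, show m < n by omega]

theorem ext_lt {n k : ℕ} (w : Fin n → Fin k) (m : ℕ) (hm : m < n) : wext w m < k := by
  simp [wext, hm]

theorem word_inj {k n : ℕ} {w w' : Fin n → Fin k}
    (h : ∀ i < k, ∀ m ≤ n, wx (wext w) i m = wx (wext w') i m) : w = w' := by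
  funext ⟨m, hm⟩
  have e1 := h (wext w m) (ext_lt w m hm) m hm.le
  have e2 := h (wext w m) (ext_lt w m hm) (m+1) hm
  rw [wx_succ, wx_succ, e1, if_pos rfl] at e2
  split_ifs at e2 with e
  · simp only [wext, hm, dif_pos] at e
    exact (Fin.ext e).symm
  · omega

def goodWords (k n : ℕ) (g : ℕ → ℕ → ℤ) (y : ℕ → ℕ) : Set (Fin n → Fin k) :=
  {w | (∀ m ≤ n, ∀ i, i < k → G k (wx (wext w)) i m = g i m) ∧
    ∀ i, i < k → wx (wext w) i n = (y i : ℤ)}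

theorem initsum_eq {k : ℕ} {u v : ℕ → ℤ}
    (h : ∀ r ≤ k, ∑ i ∈ Finset.range r, u i = ∑ i ∈ Finset.range r, v i) :
    ∀ i < k, u i = v i := by
  intro i hi
  have h1 := h i hi.le
  have h2 := h (i+1) hi
  rw [Finset.sum_range_succ, Finset.sum_range_succ] at h2
  omega

theorem count_words (k n : ℕ) (g : ℕ → ℕ → ℤ) (y : ℕ → ℕ) (hg : PathOn k n g) (hW : Wc k n g)
    (hgs : ∀ m ≤ n, ∑ i ∈ Finset.range k, g i m = m) :
    (goodWords k n g y).ncard = kostka k (revPartZ k (fun i => g i n)) y := by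
  set lam := revPartZ k (fun i => g i n) with hlam
  let LL : (Fin n → Fin k) → ℕ → ℕ → ℕ :=
    fun w r => revPartZ r (fun i => G r (wx (wext w)) i n)
  have hGT : ∀ w, IsGT k (LL w) := fun w => gt_of_path (wx_path _ k n)
  have hLk : ∀ w ∈ goodWords k n g y, LL w k = lam := by
    intro w hw
    funext ρ
    simp only [LL, hlam, revPartZ]
    split_ifs with h
    · rw [hw.1 n le_rfl _ (by omega)]
    · rfl
  have hrow : ∀ w, ∀ r ≤ k, ((∑ ρ ∈ Finset.range k, LL w r ρ : ℕ) : ℤ)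
      = ∑ i ∈ Finset.range r, wx (wext w) i n := by
    intro w r hr
    have hp := wx_path (wext w) r n
    obtain ⟨a1, a2, a3⟩ := G_all n _ r hp
    rw [← a3 n le_rfl]
    exact rev_sum hr _ (fun i hi => a1.nonneg hi n le_rfl)
  have hrep : ∀ w, TRep k (LL w) (Tab k (LL w)) := fun w => tab_rep (hGT w)
  rw [kostka]
  apply Set.ncard_congr (fun w _ => Tab k (LL w))
  · intro w hw
    have hs := rep_ssyt (hGT w) (hrep w)
    rw [hLk w hw] at hs
    refine ⟨hs, ?_⟩
    have := initsum_eq (k := k) (u := fun i => (entryCount k lam (Tab k (LL w)) i : ℤ))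
      (v := fun i => (y i : ℤ)) ?_
    · intro i hi; exact_mod_cast this i hi
    · intro r hr
      have e := rep_count (hGT w) (hrep w) hr
      rw [hLk w hw] at e
      have e2 := hrow w r hr
      rw [← e] at e2
      push_cast at e2
      rw [e2]
      exact Finset.sum_congr rfl fun i hi => hw.2 i (by simp at hi; omega)
  · intro w w' hw hw' heq
    have hr' := hrep w'
    rw [← heq] at hr'
    apply word_inj
    apply G_uniq k (wx_path _ k n) (wx_path _ k n)
    · intro i hi m hm
      rw [hw.1 m hm i hi, hw'.1 m hm i hi]
    · intro r hr i hi
      have e := rep_inj (hGT w) (hGT w') (hrep w) hr' (by rw [hLk w hw, hLk w' hw']) hr (r-1-i)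
      simp only [LL, revPartZ, show r - 1 - i < r by omega, if_pos,
        show r - 1 - (r - 1 - i) = i by omega] at e
      have p1 := (G_all n _ r (wx_path (wext w) r n)).1.nonneg hi n le_rfl
      have p2 := (G_all n _ r (wx_path (wext w') r n)).1.nonneg hi n le_rfl
      omega
  · rintro T ⟨hT, hy⟩
    have hanti : ∀ ρ, lam (ρ+1) ≤ lam ρ := by
      intro ρ
      simp only [hlam, revPartZ]
      split_ifs with h1 h2
      · apply Int.toNat_le_toNat
        have := hW n le_rfl (k-1-(ρ+1)) (by omega)
        rwa [show k - 1 - (ρ+1) + 1 = k - 1 - ρ by omega] at this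
      · omega
      · omega
      · omega
    obtain ⟨L, hL, hR, hk⟩ := of_ssyt hT hanti
    obtain ⟨x, x1, x2, x3⟩ := G_exists k g hg hW (fun r i => (L r (r-1-i) : ℤ))
      (by
        intro i hi
        have := hg.nonneg hi n le_rfl
        simp only [hk, hlam, revPartZ, show k - 1 - i < k by omega, if_pos,
          show k - 1 - (k - 1 - i) = i by omega]
        omega)
      (by
        intro r hr i hi
        have e1 := hL.lo r hr (r-1-i)
        have e2 := hL.hi r hr (r-1-i)
        simp only
        rw [show r + 1 - 1 - i = r - 1 - i + 1 by omega,
          show r + 1 - 1 - (i+1) = r - 1 - i by omega]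
        exact ⟨by exact_mod_cast e1, by exact_mod_cast e2⟩)
    obtain ⟨w, hw⟩ := word_exists x1 (by
      intro m hm
      rw [← (G_all n x k x1).2.2 m hm, ← hgs m hm]
      exact Finset.sum_congr rfl fun i hi => x2 m hm i (by simpa using hi))
    have hGw : ∀ r ≤ k, ∀ m ≤ n, ∀ i < r, G r (wx (wext w)) i m = G r x i m := by
      intro r hr
      apply G_congr
      intro i hi
      exact hw i (by omega)
    have hLL : ∀ r ≤ k, LL w r = L r := by
      intro r hr
      funext ρ
      simp only [LL, revPartZ]
      split_ifs with h
      · rw [hGw r hr n le_rfl _ (by omega), x3 r hr _ (by omega)]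
        simp [show r - 1 - (r - 1 - ρ) = ρ by omega]
      · rw [hL.zero r hr ρ (by omega)]
    have hRT : TRep k (LL w) T := by
      refine ⟨?_, ?_⟩
      · rw [hLL k le_rfl]; exact hR.out
      · intro ρ c hc r hr
        rw [hLL k le_rfl] at hc
        rw [hLL r hr]
        exact hR.iff ρ c hc r hr
    refine ⟨w, ⟨?_, ?_⟩, rep_unique (hrep w) hRT⟩
    · intro m hm i hi
      rw [hGw k le_rfl m hm i hi, x2 m hm i hi]
    · apply initsum_eq
      intro r hr
      have e1 := hrow w r hr
      rw [hLL r hr, ← rep_count hL hR hr, hk] at e1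
      rw [← e1]
      push_cast
      exact Finset.sum_congr rfl fun i hi => by rw [hy i (by simp at hi; omega)]

theorem word_prob {Ω : Type*} [MeasureSpace Ω] (k : ℕ) (p : ℕ → ℝ)
    (hp0 : ∀ i, i < k → 0 ≤ p i)
    (ξ : ℕ → Ω → ℕ) (hindep : iIndepFun ξ (ℙ : Measure Ω))
    (hlaw : ∀ m i, i < k → (ℙ : Measure Ω) {ω | ξ m ω = i} = ENNReal.ofReal (p i))
    (n : ℕ) (u : ℕ → ℕ) (hu : ∀ m < n, u m < k) (y : ℕ → ℕ)
    (hy : ∀ i < k, wx u i n = (y i : ℤ)) :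
    (ℙ : Measure Ω) {ω | ∀ m < n, ξ m ω = u m}
      = ENNReal.ofReal (∏ i ∈ Finset.range k, p i ^ y i) := by
  have e : {ω | ∀ m < n, ξ m ω = u m} = ⋂ m ∈ Finset.range n, ξ m ⁻¹' {u m} := by
    ext ω; simp
  rw [e, hindep.measure_inter_preimage_eq_mul (Finset.range n) (sets := fun m => {u m})
    (fun _ _ => measurableSet_singleton _)]
  have h1 : ∀ m ∈ Finset.range n, (ℙ : Measure Ω) (ξ m ⁻¹' {u m}) = ENNReal.ofReal (p (u m)) := by
    intro m hm
    exact hlaw m (u m) (hu m (by simpa using hm))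
  rw [Finset.prod_congr rfl h1, ← ENNReal.ofReal_prod_of_nonneg
    (fun m hm => hp0 _ (hu m (by simpa using hm)))]
  congr 1
  rw [← Finset.prod_fiberwise_of_maps_to' (t := Finset.range k) (g := u)
    (fun m hm => by simpa using hu m (by simpa using hm))]
  apply Finset.prod_congr rfl
  intro i hi
  rw [Finset.prod_const]
  congr 1
  have := hy i (by simpa using hi)
  rw [wx] at this
  exact_mod_cast this

/-- the joint law of the transformed walk and the position of the
original walk: `P(G^{(k)}(X)(m) = g(m) ∀ m ≤ n, X(n) = y) = p^y κ_{g(n)^*, y}`. -/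
theorem stmt14 {Ω : Type*} [MeasureSpace Ω] [IsProbabilityMeasure (ℙ : Measure Ω)]
    (k : ℕ) (hk : 2 ≤ k) (p : ℕ → ℝ)
    (hp0 : ∀ i, i < k → 0 ≤ p i)
    (hsum : ∑ i ∈ Finset.range k, p i = 1)
    (ξ : ℕ → Ω → ℕ) (hmeas : ∀ m, Measurable (ξ m))
    (hindep : iIndepFun ξ ℙ)
    (hlaw : ∀ m i, i < k → ℙ {ω | ξ m ω = i} = ENNReal.ofReal (p i))
    (n : ℕ) (hn : 1 ≤ n) (g : ℕ → ℕ → ℤ)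
    (hg0 : ∀ i, i < k → g i 0 = 0)
    (hgstep : ∀ m, 1 ≤ m → m ≤ n →
      ∃ j, j < k ∧ g j m = g j (m-1) + 1 ∧ ∀ i, i < k → i ≠ j → g i m = g i (m-1))
    (hgW : ∀ m ≤ n, ∀ i, i + 1 < k → g i m ≤ g (i+1) m)
    (y : ℕ → ℕ) (hy : ∑ i ∈ Finset.range k, y i = n) :
    ℙ {ω | (∀ m ≤ n, ∀ i, i < k →
          G k (fun i' n' => Xcnt ξ i' n' ω) i m = g i m) ∧
        (∀ i, i < k → Xcnt ξ i n ω = (y i : ℤ))}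
      = ENNReal.ofReal ((∏ i ∈ Finset.range k, p i ^ y i)
          * (kostka k (revPartZ k (fun i => g i n)) y : ℝ)) := by
  classical
  have hgP : PathOn k n g := by
    refine ⟨hg0, ?_, ?_⟩
    · intro i hi m hm
      obtain ⟨j, hj, h1, h2⟩ := hgstep (m+1) (by omega) (by omega)
      simp only [Nat.add_sub_cancel] at h1 h2
      by_cases e : i = j
      · subst e; omega
      · exact (h2 i hi e).ge
    · intro m hm
      obtain ⟨j, hj, h1, h2⟩ := hgstep (m+1) (by omega) (by omega)
      simp only [Nat.add_sub_cancel] at h1 h2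
      have hj' : j ∈ Finset.range k := by simpa using hj
      rw [← Finset.add_sum_erase _ _ hj', ← Finset.add_sum_erase _ (fun i => g i m) hj', h1,
        Finset.sum_congr rfl (fun i hi => h2 i (by simp at hi; exact hi.2) (by simp at hi; exact hi.1))]
      omega
  have hgs : ∀ m ≤ n, ∑ i ∈ Finset.range k, g i m = m := by
    intro m
    induction m with
    | zero => intro _; exact Finset.sum_eq_zero fun i hi => hg0 i (by simpa using hi)
    | succ m ih =>
      intro hm
      obtain ⟨j, hj, h1, h2⟩ := hgstep (m+1) (by omega) (by omega)
      simp only [Nat.add_sub_cancel] at h1 h2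
      have hj' : j ∈ Finset.range k := by simpa using hj
      have := ih (by omega)
      rw [← Finset.add_sum_erase _ _ hj'] at this
      rw [← Finset.add_sum_erase _ _ hj', h1,
        Finset.sum_congr rfl (fun i hi => h2 i (by simp at hi; exact hi.2) (by simp at hi; exact hi.1))]
      push_cast
      omega
  have hfin : (goodWords k n g y).Finite := Set.toFinite _
  have hEv : {ω | (∀ m ≤ n, ∀ i, i < k →
          G k (fun i' n' => Xcnt ξ i' n' ω) i m = g i m) ∧
        (∀ i, i < k → Xcnt ξ i n ω = (y i : ℤ))}
      = ⋃ w ∈ hfin.toFinset, {ω | ∀ m < n, ξ m ω = wext w m} := by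
    ext ω
    simp only [Set.mem_setOf_eq, Set.mem_iUnion, Set.Finite.mem_toFinset, exists_prop]
    have hX : (fun i' n' => Xcnt ξ i' n' ω) = wx (fun m => ξ m ω) := rfl
    have hX' : ∀ i, Xcnt ξ i n ω = wx (fun m => ξ m ω) i n := fun _ => rfl
    rw [hX]
    simp only [hX']
    constructor
    · rintro ⟨h1, h2⟩
      have hlt : ∀ m < n, ξ m ω < k := by
        apply wx_full (fun m => ξ m ω) k n
        rw [Finset.sum_congr rfl (fun i hi => h2 i (by simpa using hi)), ← hy]
        push_cast; rfl
      have he : ∀ m < n, ξ m ω = wext (fun m : Fin n => (⟨ξ m ω, hlt m m.2⟩ : Fin k)) m := by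
        intro m hm
        simp [wext, hm]
      refine ⟨_, ⟨?_, ?_⟩, he⟩
      · intro m hm i hi
        rw [← h1 m hm i hi]
        exact G_congr k (fun i _ m hm => (wx_congr he i m hm).symm) m hm i hi
      · intro i hi
        rw [← h2 i hi]
        exact (wx_congr he i n le_rfl).symm
    · rintro ⟨w, ⟨h1, h2⟩, he⟩
      refine ⟨?_, ?_⟩
      · intro m hm i hi
        rw [← h1 m hm i hi]
        exact G_congr k (fun i _ m hm => wx_congr he i m hm) m hm i hi
      · intro i hi
        rw [← h2 i hi]
        exact wx_congr he i n le_rfl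
  rw [hEv, measure_biUnion_finset]
  · rw [Finset.sum_congr rfl (fun w hw => word_prob k p hp0 ξ hindep hlaw n (wext w)
      (ext_lt w) y (((Set.Finite.mem_toFinset hfin).1 hw).2)), Finset.sum_const,
      ← Set.ncard_eq_toFinset_card _ hfin, count_words k n g y hgP hgW hgs, nsmul_eq_mul,
      mul_comm (∏ i ∈ Finset.range k, p i ^ y i), ENNReal.ofReal_mul (by positivity),
      ENNReal.ofReal_natCast]
  · intro w _ w' _ hne
    rw [Function.onFun, Set.disjoint_left]
    intro ω h1 h2
    apply hne
    funext ⟨m, hm⟩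
    have e1 := h1 m hm
    have e2 := h2 m hm
    rw [e1] at e2
    simp only [wext, hm, dif_pos] at e2
    exact Fin.ext e2
  · intro w _
    have : {ω | ∀ m < n, ξ m ω = wext w m} = ⋂ m ∈ Finset.range n, ξ m ⁻¹' {wext w m} := by
      ext ω; simp
    rw [this]
    exact Finset.measurableSet_biInter _ fun m _ => hmeas m (measurableSet_singleton _)
end

section
/- Transient distribution of two M/M/1-type queues in tandem (de-Poissonized form): let k=2, let p=(p_1,p_2) be a probability vector, and let X be the associated counting random walk. Then for all integers n≥1 and d_1,d_2≥0 with d_2≤d_1, d_2≤n−d_1 and d_1≤n: P(X_1(n)=d_1 and (X_1⊓X_2)(n)=d_2) = p_1^{d_1}·p_2^{n−d_1}·n!·(n−2d_2+1)/((n−d_2+1)!·d_2!). -/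
open MeasureTheory ProbabilityTheory

namespace Tandem

/-- coordinate words -/
def crd : ℕ → (ℕ → ℕ) → ℕ := fun m w => w m

noncomputable def D (w : ℕ → ℕ) (n : ℕ) : ℤ :=
  minOp (fun m => Xcnt crd 0 m w) (fun m => Xcnt crd 1 m w) n

lemma le_minOp (x y : ℕ → ℤ) (n : ℕ) (c : ℤ) :
    c ≤ minOp x y n ↔ ∀ m ≤ n, c ≤ x m + y n - y m := by
  unfold minOp
  rw [Finset.le_inf'_iff]
  simp [Nat.lt_succ_iff]

lemma minOp_succ (x y : ℕ → ℤ) (n : ℕ) :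
    minOp x y (n+1) = min (minOp x y n + (y (n+1) - y n)) (x (n+1)) := by
  apply eq_of_forall_le_iff
  intro c
  rw [le_minOp, le_min_iff, ← sub_le_iff_le_add, le_minOp]
  constructor
  · intro h
    refine ⟨fun m hm => ?_, ?_⟩
    · have := h m (by omega)
      linarith
    · have := h (n+1) le_rfl
      linarith
  · rintro ⟨h1, h2⟩ m hm
    rcases Nat.lt_or_ge n m with h | h
    · have : m = n+1 := by omega
      subst this
      linarith
    · have := h1 m h
      linarith

lemma X_succ (w : ℕ → ℕ) (i n : ℕ) :
    Xcnt crd i (n+1) w = Xcnt crd i n w + if w n = i then 1 else 0 := by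
  unfold Xcnt crd
  rw [Finset.range_add_one, Finset.filter_insert]
  split_ifs <;> simp

lemma X_zero (w : ℕ → ℕ) (i : ℕ) : Xcnt crd i 0 w = 0 := by simp [Xcnt]

lemma D_zero (w : ℕ → ℕ) : D w 0 = 0 := by
  simp [D, minOp, X_zero]

lemma D_succ (w : ℕ → ℕ) (n : ℕ) :
    D w (n+1) = min (D w n + if w n = 1 then 1 else 0)
      (Xcnt crd 0 n w + if w n = 0 then 1 else 0) := by
  unfold D
  rw [minOp_succ]
  simp only [X_succ]
  congr 2
  ring

lemma inv (w : ℕ → ℕ) (n : ℕ) : 0 ≤ D w n ∧ D w n ≤ Xcnt crd 0 n w ∧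
    Xcnt crd 0 n w + D w n ≤ n := by
  have key : 0 ≤ D w n ∧ D w n ≤ Xcnt crd 0 n w ∧ D w n ≤ Xcnt crd 1 n w ∧
    Xcnt crd 0 n w + Xcnt crd 1 n w ≤ n := by
    induction n with
    | zero => simp [D_zero, X_zero]
    | succ n ih =>
      rw [D_succ, X_succ, X_succ]
      push_cast
      split_ifs <;> omega
  omega

lemma step (w : ℕ → ℕ) (n : ℕ) (hw : w n < 2) (a d : ℤ) :
    (Xcnt crd 0 (n+1) w = a ∧ D w (n+1) = d) ↔
      ((Xcnt crd 0 n w = a - 1 ∧ D w n = d) ∧ w n = 0) ∨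
      (((Xcnt crd 0 n w = a ∧ D w n = d - 1) ∧ d ≤ a) ∧ w n = 1) ∨
      (((Xcnt crd 0 n w = a ∧ D w n = d) ∧ d = a) ∧ w n = 1) := by
  have := inv w n
  rw [D_succ, X_succ]
  have : w n = 0 ∨ w n = 1 := by omega
  rcases this with h | h <;> simp [h] <;> omega

lemma congrD (w v : ℕ → ℕ) (n : ℕ) (h : ∀ m < n, w m = v m) :
    Xcnt crd 0 n w = Xcnt crd 0 n v ∧ D w n = D v n := by
  induction n with
  | zero => simp [D_zero, X_zero]
  | succ n ih =>
    obtain ⟨h1, h2⟩ := ih (fun m hm => h m (by omega))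
    rw [D_succ, D_succ, X_succ, X_succ, h n (by omega), h1, h2]
    simp

def f (n d : ℕ) : ℝ := if d = 0 then 1 else (n.choose d : ℝ) - n.choose (d-1)

lemma f_succ (n d : ℕ) : f (n+1) (d+1) = f n (d+1) + f n d := by
  rcases d with _ | d
  · simp [f]
  · simp [f, Nat.choose_succ_succ]
    ring

lemma f_half (d : ℕ) : f (2*d+1) (d+1) = 0 := by
  have := Nat.choose_symm_half d
  simp [f, this]

lemma f_formula (n d : ℕ) (h : 2*d ≤ n) :
    f n d = (n.factorial : ℝ) * ((n - 2*d + 1 : ℕ) : ℝ)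
          / (((n - d + 1).factorial : ℝ) * (d.factorial : ℝ)) := by
  obtain ⟨k, rfl⟩ := Nat.exists_eq_add_of_le h
  rcases d with _ | d
  · simp [f, Nat.factorial_succ]
    field_simp
  · have e1 := Nat.add_choose (d+1+k) (d+1)
    simp only [f, Nat.add_one_ne_zero, if_false, Nat.add_sub_cancel]
    rw [Nat.cast_choose ℝ (show d+1 ≤ 2*(d+1)+k by omega),
      Nat.cast_choose ℝ (show d ≤ 2*(d+1)+k by omega)]
    rw [show 2*(d+1)+k-(d+1) = d+1+k by omega, show 2*(d+1)+k-d = d+1+k+1 by omega,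
      show 2*(d+1)+k-2*(d+1)+1 = k+1 by omega, Nat.factorial_succ (d+1+k), Nat.factorial_succ d]
    push_cast
    have h1 : ((d+1+k).factorial : ℝ) ≠ 0 := by positivity
    have h2 : (d.factorial : ℝ) ≠ 0 := by positivity
    have h3 : (d:ℝ)+1+k+1 ≠ 0 := by positivity
    field_simp
    ring

section prob
variable {Ω : Type*} [MeasureSpace Ω]

def wd (ξ : ℕ → Ω → ℕ) (ω : Ω) : ℕ → ℕ := fun m => ξ m ω

def Ev (ξ : ℕ → Ω → ℕ) (n : ℕ) (a d : ℤ) : Set Ω :=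
  {ω | Xcnt crd 0 n (wd ξ ω) = a ∧ D (wd ξ ω) n = d}

noncomputable def q (ξ : ℕ → Ω → ℕ) (n : ℕ) (a d : ℤ) : ℝ := (ℙ : Measure Ω).real (Ev ξ n a d)

lemma q_zero (ξ : ℕ → Ω → ℕ) (n : ℕ) (a d : ℤ) (h : d < 0 ∨ a < d ∨ n < a + d) :
    q ξ n a d = 0 := by
  have : Ev ξ n a d = ∅ := by
    ext ω
    have := inv (wd ξ ω) n
    simp only [Ev, Set.mem_setOf_eq, Set.mem_empty_iff_false, iff_false]
    omega
  simp [q, this]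

def ext (n : ℕ) (v : Finset.range n → ℕ) : ℕ → ℕ :=
  fun m => if h : m ∈ Finset.range n then v ⟨m, h⟩ else 0

lemma Ev_eq (ξ : ℕ → Ω → ℕ) (n : ℕ) (a d : ℤ) :
    Ev ξ n a d = (fun ω (i : Finset.range n) => ξ i ω) ⁻¹'
      {v | Xcnt crd 0 n (ext n v) = a ∧ D (ext n v) n = d} := by
  ext1 ω
  simp only [Ev, Set.mem_setOf_eq, Set.mem_preimage]
  obtain ⟨h1, h2⟩ := congrD (wd ξ ω) (ext n (fun i : Finset.range n => ξ i ω)) n (by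
    intro m hm
    simp [ext, hm, wd])
  rw [h1, h2]

lemma Ev_meas (ξ : ℕ → Ω → ℕ) (hmeas : ∀ m, Measurable (ξ m)) (n : ℕ) (a d : ℤ) :
    MeasurableSet (Ev ξ n a d) := by
  rw [Ev_eq]
  have hm : Measurable (fun ω (i : Finset.range n) => ξ i ω) :=
    measurable_pi_lambda _ (fun i => hmeas i)
  exact hm MeasurableSet.of_discrete

lemma Ev_inter [IsProbabilityMeasure (ℙ : Measure Ω)]
    (ξ : ℕ → Ω → ℕ) (hmeas : ∀ m, Measurable (ξ m))
    (hindep : iIndepFun ξ ℙ) (n : ℕ) (a d : ℤ) (i : ℕ) :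
    (ℙ : Measure Ω).real (Ev ξ n a d ∩ {ω | ξ n ω = i}) =
      q ξ n a d * (ℙ : Measure Ω).real {ω | ξ n ω = i} := by
  have h := hindep.indepFun_finset (Finset.range n) {n} (by simp) hmeas
  have h2 := h.measure_inter_preimage_eq_mul
    {v | Xcnt crd 0 n (ext n v) = a ∧ D (ext n v) n = d}
    {v | v ⟨n, by simp⟩ = i} MeasurableSet.of_discrete MeasurableSet.of_discrete
  rw [← Ev_eq] at h2
  unfold q Measure.real
  rw [← ENNReal.toReal_mul]
  exact congrArg _ h2

lemma q_succ [IsProbabilityMeasure (ℙ : Measure Ω)] (p : ℕ → ℝ)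
    (hp0 : ∀ i, i < 2 → 0 ≤ p i)
    (hsum : p 0 + p 1 = 1)
    (ξ : ℕ → Ω → ℕ) (hmeas : ∀ m, Measurable (ξ m))
    (hindep : iIndepFun ξ ℙ)
    (hlaw : ∀ m i, i < 2 → ℙ {ω | ξ m ω = i} = ENNReal.ofReal (p i)) (n : ℕ) (a d : ℤ) :
    q ξ (n+1) a d = q ξ n (a-1) d * p 0 + (if d ≤ a then q ξ n a (d-1) * p 1 else 0)
      + (if d = a then q ξ n a d * p 1 else 0) := by
  have hl : ∀ i, i < 2 → (ℙ : Measure Ω).real {ω | ξ n ω = i} = p i := by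
    intro i hi
    rw [Measure.real, hlaw n i hi, ENNReal.toReal_ofReal (hp0 i hi)]
  have ms : ∀ i, MeasurableSet {ω | ξ n ω = i} := fun i =>
    hmeas n (measurableSet_singleton i)
  have hae : ∀ᵐ ω ∂(ℙ : Measure Ω), ξ n ω < 2 := by
    have hU : (ℙ : Measure Ω).real ({ω | ξ n ω = 0} ∪ {ω | ξ n ω = 1}) = 1 := by
      rw [measureReal_union _ (ms 1), hl 0 (by norm_num), hl 1 (by norm_num), hsum]
      rw [Set.disjoint_left]
      intro ω h1 h2
      simp_all
    have hU' : (ℙ : Measure Ω) ({ω | ξ n ω = 0} ∪ {ω | ξ n ω = 1}) = 1 := by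
      rw [Measure.real] at hU
      exact (ENNReal.toReal_eq_one_iff _).1 hU
    have := (prob_compl_eq_zero_iff ((ms 0).union (ms 1))).2 hU'
    filter_upwards [measure_eq_zero_iff_ae_notMem.1 this] with ω hω
    simp at hω
    omega
  set A := Ev ξ n (a-1) d ∩ {ω | ξ n ω = 0} with hA
  set B := if d ≤ a then Ev ξ n a (d-1) ∩ {ω | ξ n ω = 1} else ∅ with hB
  set C := if d = a then Ev ξ n a d ∩ {ω | ξ n ω = 1} else ∅ with hC
  have mB : MeasurableSet B := by
    rw [hB]; split_ifs
    · exact (Ev_meas ξ hmeas _ _ _).inter (ms 1)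
    · exact MeasurableSet.empty
  have mC : MeasurableSet C := by
    rw [hC]; split_ifs
    · exact (Ev_meas ξ hmeas _ _ _).inter (ms 1)
    · exact MeasurableSet.empty
  have e : q ξ (n+1) a d = (ℙ : Measure Ω).real (A ∪ B ∪ C) := by
    unfold q
    apply measureReal_congr
    filter_upwards [hae] with ω hω
    have := step (wd ξ ω) n hω a d
    apply propext
    change (Xcnt crd 0 (n+1) (wd ξ ω) = a ∧ D (wd ξ ω) (n+1) = d) ↔ ω ∈ A ∪ B ∪ C
    rw [this, hA, hB, hC]
    by_cases h1 : d ≤ a <;> by_cases h2 : d = a <;>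
      simp [h1, h2, Ev, wd, or_assoc] 
  have dAB : Disjoint A B := by
    rw [Set.disjoint_left, hA, hB]
    rintro ω ⟨_, h1⟩ h2
    split_ifs at h2
    · have := h2.2
      simp_all
    · exact h2
  have dC : Disjoint (A ∪ B) C := by
    rw [Set.disjoint_left, hA, hB, hC]
    rintro ω h1 h2
    split_ifs at h2
    · rcases h1 with h1 | h1
      · have := h1.2
        have := h2.2
        simp_all
      · split_ifs at h1
        · have h3 := h1.1.2
          have h4 := h2.1.2
          omega
        · exact h1
    · exact h2
  rw [e, measureReal_union dC mC, measureReal_union dAB mB]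
  congr 1
  · congr 1
    · rw [hA, Ev_inter ξ hmeas hindep, hl 0 (by norm_num)]
    · rw [hB]; split_ifs
      · rw [Ev_inter ξ hmeas hindep, hl 1 (by norm_num)]
      · simp
  · rw [hC]; split_ifs
    · rw [Ev_inter ξ hmeas hindep, hl 1 (by norm_num)]
    · simp

lemma q_formula [IsProbabilityMeasure (ℙ : Measure Ω)] (p : ℕ → ℝ)
    (hp0 : ∀ i, i < 2 → 0 ≤ p i)
    (hsum : p 0 + p 1 = 1)
    (ξ : ℕ → Ω → ℕ) (hmeas : ∀ m, Measurable (ξ m))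
    (hindep : iIndepFun ξ ℙ)
    (hlaw : ∀ m i, i < 2 → ℙ {ω | ξ m ω = i} = ENNReal.ofReal (p i)) (n : ℕ) :
    ∀ a d : ℕ, d ≤ a → a + d ≤ n → q ξ n a d = p 0 ^ a * p 1 ^ (n-a) * f n d := by
  induction n with
  | zero =>
    intro a d h1 h2
    obtain rfl : a = 0 := by omega
    obtain rfl : d = 0 := by omega
    simp [q, Ev, D_zero, X_zero, f]
  | succ n ih =>
    intro a d h1 h2
    rw [q_succ p hp0 hsum ξ hmeas hindep hlaw, if_pos (by exact_mod_cast h1)]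
    rcases h1.lt_or_eq with h | h
    · rw [if_neg (by exact_mod_cast h.ne)]
      obtain ⟨b, rfl⟩ : ∃ b, a = b + 1 := ⟨a-1, by omega⟩
      rw [show ((b+1 : ℕ) : ℤ) - 1 = (b : ℕ) by push_cast; ring, ih b d (by omega) (by omega)]
      rcases d with _ | d
      · rw [q_zero ξ n _ (((0:ℕ):ℤ) - 1) (by left; simp)]
        simp [f]
        ring
      · rw [show ((d+1 : ℕ) : ℤ) - 1 = (d : ℕ) by push_cast; ring,
          ih (b+1) d (by omega) (by omega), f_succ]
        rw [show n + 1 - (b+1) = (n - (b+1)) + 1 by omega, show n - b = (n - (b+1)) + 1 by omega]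
        ring
    · subst h
      rw [if_pos rfl, q_zero ξ n _ _ (by right; left; omega)]
      rcases d with _ | d
      · rw [q_zero ξ n _ (((0:ℕ):ℤ) - 1) (by left; simp), ih 0 0 (by omega) (by omega)]
        simp [f]
        ring
      · rw [show ((d+1 : ℕ) : ℤ) - 1 = (d : ℕ) by push_cast; ring,
          ih (d+1) d (by omega) (by omega), f_succ]
        have : q ξ n (d+1 : ℕ) (d+1 : ℕ) = p 0 ^ (d+1) * p 1 ^ (n-(d+1)) * f n (d+1) := by
          by_cases hh : d + 1 + (d + 1) ≤ n
          · exact ih _ _ le_rfl hh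
          · rw [q_zero ξ n _ _ (by right; right; push_cast; omega)]
            obtain rfl : n = 2*d+1 := by omega
            rw [f_half]; ring
        rw [this, show n + 1 - (d+1) = (n - (d+1)) + 1 by omega]
        ring
end prob

end Tandem

/-- transient distribution of the tandem queue (`k = 2`,
de-Poissonized form):
`P(X_1(n)=d_1, (X_1⊓X_2)(n)=d_2) = p_1^{d_1} p_2^{n-d_1} n! (n-2d_2+1)/((n-d_2+1)! d_2!)`. -/
theorem stmt17 {Ω : Type*} [MeasureSpace Ω] [IsProbabilityMeasure (ℙ : Measure Ω)]
    (p : ℕ → ℝ)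
    (hp0 : ∀ i, i < 2 → 0 ≤ p i)
    (hsum : p 0 + p 1 = 1)
    (ξ : ℕ → Ω → ℕ) (hmeas : ∀ m, Measurable (ξ m))
    (hindep : iIndepFun ξ ℙ)
    (hlaw : ∀ m i, i < 2 → ℙ {ω | ξ m ω = i} = ENNReal.ofReal (p i))
    (n d1 d2 : ℕ) (hn : 1 ≤ n) (hd1n : d1 ≤ n) (hd21 : d2 ≤ d1) (hd2n : d1 + d2 ≤ n) :
    ℙ {ω | Xcnt ξ 0 n ω = (d1 : ℤ) ∧
        minOp (fun m => Xcnt ξ 0 m ω) (fun m => Xcnt ξ 1 m ω) n = (d2 : ℤ)}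
      = ENNReal.ofReal (p 0 ^ d1 * p 1 ^ (n - d1) * (n.factorial : ℝ)
          * ((n - 2*d2 + 1 : ℕ) : ℝ)
          / (((n - d2 + 1).factorial : ℝ) * (d2.factorial : ℝ))) := by
  have h := Tandem.q_formula p hp0 hsum ξ hmeas hindep hlaw n d1 d2 hd21 hd2n
  rw [Tandem.f_formula n d2 (by omega)] at h
  have e : ℙ {ω | Xcnt ξ 0 n ω = (d1 : ℤ) ∧
        minOp (fun m => Xcnt ξ 0 m ω) (fun m => Xcnt ξ 1 m ω) n = (d2 : ℤ)}
      = ENNReal.ofReal (Tandem.q ξ n d1 d2) :=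
    (ENNReal.ofReal_toReal (measure_ne_top _ _)).symm
  rw [e, h]
  congr 1
  ring
end
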